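/- arXiv:2306.10779 — 2 statements merged into one kernel-verified Lean document; each statement's English description precedes it below -/
import Mathlib

section
/- Fix m ∈ {1,…,p} and suppose the m-th column of Λ is zero, i.e. [Λ]_{nm} = 0 for all n = 1,…,p. Assume that for each j the map u ↦ g(x_j, β, u) is three times continuously differentiable on ℝ^p and that, on a neighbourhood of Λ, all partial derivatives of the integrand up to order three with respect to the entries [Λ]_{nm} are dominated by a function of ξ integrable with respect to the standard Gaussian measure on ℝ^p. Then for every n_1, n_2, n_3 ∈ {1,…,p} and every y ∈ ℝ^J, the third-order partial derivative ∂³f(y;θ)/∂[Λ]_{n_1 m}∂[Λ]_{n_2 m}∂[Λ]_{n_3 m} equals 0; consequently (using also the vanishing of the first-order derivatives) all third-order partial derivatives of log f(y;θ) with respect to the entries of the m-th column of Λ vanish for every y. -/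
open MeasureTheory

/-- The standard Gaussian measure on `ℝ^p`, defined as Lebesgue measure weighted by the
standard Gaussian density. -/
noncomputable def stdGaussianPi (p : ℕ) : Measure (Fin p → ℝ) :=
  volume.withDensity fun ξ =>
    ENNReal.ofReal ((2 * Real.pi) ^ (-(p : ℝ) / 2) * Real.exp (-(∑ k, (ξ k) ^ 2) / 2))

/-- The conditional Gaussian density of the observation `y ∈ ℝ^J` given the random effect
`ξ ∈ ℝ^p`, for noise variance `σ²`, response functions `G j = g(x_j, β, ·)` and scaling
matrix `L = Λ`. -/
noncomputable def condDensity (J p : ℕ) (σ2 : ℝ) (G : Fin J → (Fin p → ℝ) → ℝ)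
    (L : Matrix (Fin p) (Fin p) ℝ) (y : Fin J → ℝ) (ξ : Fin p → ℝ) : ℝ :=
  (2 * Real.pi * σ2) ^ (-(J : ℝ) / 2) *
    Real.exp (-(∑ j, (y j - G j (L.mulVec ξ)) ^ 2) / (2 * σ2))

/-- The marginal density of an observation in the nonlinear mixed-effects model: the
conditional density given the random effect, integrated against the standard Gaussian
distribution of the random effect. -/
noncomputable def margDensity (J p : ℕ) (σ2 : ℝ) (G : Fin J → (Fin p → ℝ) → ℝ)
    (L : Matrix (Fin p) (Fin p) ℝ) (y : Fin J → ℝ) : ℝ :=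
  ∫ ξ, condDensity J p σ2 G L y ξ ∂(stdGaussianPi p)

/-- The matrix supported on the `m`-th column, with that column equal to `v`. Adding
`colMat p m v` to `Λ` perturbs exactly the entries `[Λ]_{n m}`, `n = 1, …, p`. -/
def colMat (p : ℕ) (m : Fin p) (v : Fin p → ℝ) : Matrix (Fin p) (Fin p) ℝ :=
  Matrix.of fun i j => if j = m then v i else 0

/-!
Vanishing of the third-order derivatives with respect to the entries of a null column of
`Λ`: if the `m`-th column of `Λ` is zero, `g(x_j, β, ·)` is `C³` and all partial
derivatives of the integrand up to order three with respect to the entries of the `m`-th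
column are dominated near `Λ` by a Gaussian-integrable function of `ξ`, then all
third-order partial derivatives `∂³f(y;θ)/∂[Λ]_{n₁m}∂[Λ]_{n₂m}∂[Λ]_{n₃m}` vanish, and
(using also the vanishing of the first-order derivatives) so do all third-order partial
derivatives of `log f(y;θ)` in these directions.
-/

/-- Reflection of the `m`-th coordinate. -/
def flipCoord (p : ℕ) (m : Fin p) (ξ : Fin p → ℝ) : Fin p → ℝ :=
  fun k => if k = m then -ξ k else ξ k

theorem flipCoord_invol (p : ℕ) (m : Fin p) : Function.Involutive (flipCoord p m) := by
  intro ξ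
  funext k
  by_cases hk : k = m <;> simp [flipCoord, hk]

theorem flipCoord_mp (p : ℕ) (m : Fin p) :
    MeasurePreserving (flipCoord p m) volume volume := by
  have h := volume_preserving_pi (ι := Fin p) (α' := fun _ => ℝ) (β' := fun _ => ℝ)
    (f := fun k (x : ℝ) => if k = m then -x else x) (fun k => by
      by_cases hk : k = m
      · simpa [hk] using Measure.measurePreserving_neg (volume : Measure ℝ)
      · simp only [hk, if_false]
        exact MeasurePreserving.id (volume : Measure ℝ))
  exact h

theorem mulVec_flip (p : ℕ) (L : Matrix (Fin p) (Fin p) ℝ) (m : Fin p)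
    (hcol : ∀ n, L n m = 0) (v ξ : Fin p → ℝ) :
    (L + colMat p m v).mulVec (flipCoord p m ξ) = (L + colMat p m (-v)).mulVec ξ := by
  funext i
  simp only [Matrix.mulVec, dotProduct]
  refine Finset.sum_congr rfl fun k _ => ?_
  by_cases hk : k = m
  · subst hk
    simp [colMat, flipCoord, hcol]
  · simp [colMat, flipCoord, hk]

theorem marg_even (p J : ℕ) (σ2 : ℝ) (G : Fin J → (Fin p → ℝ) → ℝ)
    (L : Matrix (Fin p) (Fin p) ℝ) (m : Fin p) (hcol : ∀ n, L n m = 0)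
    (y : Fin J → ℝ) (v : Fin p → ℝ) :
    margDensity J p σ2 G (L + colMat p m (-v)) y = margDensity J p σ2 G (L + colMat p m v) y := by
  unfold margDensity stdGaussianPi
  have hm : Measurable fun ξ : Fin p → ℝ =>
      ENNReal.ofReal ((2 * Real.pi) ^ (-(p : ℝ) / 2) * Real.exp (-(∑ k, (ξ k) ^ 2) / 2)) := by
    fun_prop
  rw [integral_withDensity_eq_integral_toReal_smul hm (by simp),
    integral_withDensity_eq_integral_toReal_smul hm (by simp)]
  have hmp := flipCoord_mp p m
  have hemb : MeasurableEmbedding (flipCoord p m) :=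
    (MeasurableEquiv.ofInvolutive (flipCoord p m) (flipCoord_invol p m)
      hmp.measurable).measurableEmbedding
  symm
  rw [← hmp.integral_comp hemb]
  congr 1
  funext ξ
  have h1 : ∑ k, (flipCoord p m ξ k) ^ 2 = ∑ k, (ξ k) ^ 2 := by
    refine Finset.sum_congr rfl fun k _ => ?_
    by_cases hk : k = m <;> simp [flipCoord, hk]
  rw [h1]
  simp only [condDensity, mulVec_flip p L m hcol v ξ]

theorem iteratedFDeriv_three_even {p : ℕ} (f : (Fin p → ℝ) → ℝ) (hf : ∀ v, f (-v) = f v) :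
    iteratedFDeriv ℝ 3 f 0 = 0 := by
  have h := (ContinuousLinearEquiv.neg ℝ (M := Fin p → ℝ)).iteratedFDerivWithin_comp_right f
    (s := Set.univ) uniqueDiffOn_univ (x := 0) (Set.mem_univ _) 3
  have hfc : f ∘ (ContinuousLinearEquiv.neg ℝ (M := Fin p → ℝ)) = f := by
    funext v
    exact hf v
  rw [hfc, Set.preimage_univ, iteratedFDerivWithin_univ, map_zero] at h
  ext w
  have h2 := DFunLike.congr_fun h w
  have h3 : (fun i => -w i) = fun i => (-1 : ℝ) • w i := by
    funext i
    simp
  have h4 := (iteratedFDeriv ℝ 3 f 0).map_smul_univ (fun _ => (-1 : ℝ)) w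
  rw [ContinuousMultilinearMap.compContinuousLinearMap_apply] at h2
  change _ = iteratedFDeriv ℝ 3 f 0 (fun i => -w i) at h2
  rw [h3, h4] at h2
  simp at h2
  simp
  linarith

theorem stmt_1 (p J : ℕ) (σ2 : ℝ) (hσ2 : 0 < σ2)
    (G : Fin J → (Fin p → ℝ) → ℝ) (hG : ∀ j, ContDiff ℝ 3 (G j))
    (L : Matrix (Fin p) (Fin p) ℝ) (m : Fin p) (hcol : ∀ n, L n m = 0)
    (hdom : ∃ ε : ℝ, 0 < ε ∧ ∃ h : (Fin p → ℝ) → ℝ,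
      Integrable h (stdGaussianPi p) ∧
      ∀ k : ℕ, k ≤ 3 → ∀ v : Fin p → ℝ, ‖v‖ < ε → ∀ (ξ : Fin p → ℝ) (y : Fin J → ℝ),
        ‖iteratedFDeriv ℝ k (fun w => condDensity J p σ2 G (L + colMat p m w) y ξ) v‖ ≤ h ξ)
    (hpos : ∀ y : Fin J → ℝ, 0 < margDensity J p σ2 G L y) :
    ∀ (y : Fin J → ℝ) (n₁ n₂ n₃ : Fin p),
      (iteratedFDeriv ℝ 3 (fun v => margDensity J p σ2 G (L + colMat p m v) y) 0)
        ![Pi.single n₁ 1, Pi.single n₂ 1, Pi.single n₃ 1] = 0 ∧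
      (iteratedFDeriv ℝ 3
          (fun v => Real.log (margDensity J p σ2 G (L + colMat p m v) y)) 0)
        ![Pi.single n₁ 1, Pi.single n₂ 1, Pi.single n₃ 1] = 0 := by
  intro y n₁ n₂ n₃
  have he := marg_even p J σ2 G L m hcol y
  rw [iteratedFDeriv_three_even _ he,
    iteratedFDeriv_three_even _ (fun v => congrArg Real.log (he v))]
  simp
end

section
/- Let Θ be a compact metric space, σ : Θ → [σ_min, σ_max] ⊂ (0, ∞) continuous, g : Θ × ℝ^p → ℝ^J jointly continuous with ∫_{ℝ^p} sup_{θ∈Θ} ‖g(θ,ξ)‖⁴ dγ_p(ξ) < ∞, where γ_p is the standard Gaussian measure on ℝ^p, and let F(y;θ) = ∫_{ℝ^p} exp(−‖y − g(θ,ξ)‖²/(2σ(θ)²)) dγ_p(ξ). Then sup_{θ'∈Θ} ∫_{ℝ^p} ∫_{ℝ^J} sup_{θ∈Θ} (log F(g(θ',ξ) + σ(θ')u; θ))² dγ_J(u) dγ_p(ξ) < ∞, i.e. the squared envelope sup_θ (log F(y;θ))² of the log marginal likelihood is integrable under the data-generating distribution y = g(θ',ξ) + σ(θ')u (ξ standard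 Gaussian on ℝ^p, u standard Gaussian on ℝ^J, independent), uniformly over the data-generating parameter θ' ∈ Θ. -/
open MeasureTheory

/-- The standard Gaussian measure on `ℝ^p` (Euclidean space), defined as Lebesgue
measure weighted by the standard Gaussian density. -/
noncomputable def stdGaussian (p : ℕ) : Measure (EuclideanSpace ℝ (Fin p)) :=
  volume.withDensity fun ξ =>
    ENNReal.ofReal ((2 * Real.pi) ^ (-(p : ℝ) / 2) * Real.exp (-‖ξ‖ ^ 2 / 2))

/-!
Uniform square-integrability of the log-likelihood envelope: if
`∫ sup_θ ‖g(θ,ξ)‖⁴ dγ_p(ξ) < ∞`, then the squared envelope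
`sup_θ (log F(y;θ))²` of the log of the unnormalized marginal likelihood
`F(y;θ) = ∫ exp(−‖y − g(θ,ξ)‖²/(2σ(θ)²)) dγ_p(ξ)` is integrable under the
data-generating distribution `y = g(θ',ξ) + σ(θ')·u` (with `ξ, u` independent
standard Gaussians), uniformly over the data-generating parameter `θ' ∈ Θ`.
-/

lemma aux_integrable (p : ℕ) (b : ℝ) (hb : 0 < b) :
    Integrable (fun ξ : EuclideanSpace ℝ (Fin p) => Real.exp (-b * ‖ξ‖ ^ 2)) volume := by
  have h := GaussianFourier.integral_rexp_neg_mul_sq_norm (V := EuclideanSpace ℝ (Fin p)) hb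
  by_contra hc
  rw [integral_undef hc] at h
  have : 0 < (Real.pi / b) ^ (Module.finrank ℝ (EuclideanSpace ℝ (Fin p)) / 2 : ℝ) := by
    have := Real.pi_pos
    positivity
  linarith

lemma aux_prob (p : ℕ) : IsProbabilityMeasure (stdGaussian p) := by
  constructor
  have h := GaussianFourier.integral_rexp_neg_mul_sq_norm
    (V := EuclideanSpace ℝ (Fin p)) (b := 1 / 2) (by norm_num)
  have hi := aux_integrable p (1 / 2) (by norm_num)
  rw [stdGaussian, withDensity_apply _ MeasurableSet.univ, Measure.restrict_univ,
    ← ofReal_integral_eq_lintegral_ofReal]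
  · have e : ∀ ξ : EuclideanSpace ℝ (Fin p), -‖ξ‖ ^ 2 / 2 = -(1 / 2) * ‖ξ‖ ^ 2 := by
      intro ξ; ring
    simp_rw [e]
    rw [integral_const_mul, h]
    rw [finrank_euclideanSpace_fin]
    have : Real.pi / (1 / 2) = 2 * Real.pi := by ring
    rw [this, ← Real.rpow_add (by positivity)]
    have : -(p : ℝ) / 2 + p / 2 = 0 := by ring
    rw [this]; simp
  · refine Integrable.const_mul (hi.congr (.of_forall fun ξ => ?_)) _
    simp only; congr 1; ring
  · exact .of_forall fun ξ => by positivity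

lemma aux_moment (p : ℕ) (B : ℝ) (hB : 0 ≤ B) :
    ∫⁻ u, ENNReal.ofReal (B * ‖u‖ ^ 4) ∂(stdGaussian p) < ⊤ := by
  rw [stdGaussian, lintegral_withDensity_eq_lintegral_mul _ (by fun_prop) (by fun_prop)]
  have hi := (aux_integrable p (1 / 4) (by norm_num)).const_mul
    ((2 * Real.pi) ^ (-(p : ℝ) / 2) * (B * 32))
  refine lt_of_le_of_lt (lintegral_mono fun u => ?_) hi.lintegral_lt_top
  simp only [Pi.mul_apply]
  rw [← ENNReal.ofReal_mul (by positivity)]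
  apply ENNReal.ofReal_le_ofReal
  have h1 : ‖u‖ ^ 4 ≤ 32 * Real.exp (‖u‖ ^ 2 / 4) := by
    have := Real.quadratic_le_exp_of_nonneg (x := ‖u‖ ^ 2 / 4) (by positivity)
    nlinarith [sq_nonneg ‖u‖]
  have h2 : Real.exp (-(1 / 4) * ‖u‖ ^ 2)
      = Real.exp (-‖u‖ ^ 2 / 2) * Real.exp (‖u‖ ^ 2 / 4) := by
    rw [← Real.exp_add]; congr 1; ring
  rw [h2]
  calc _ = ((2 * Real.pi) ^ (-(p : ℝ) / 2) * B * Real.exp (-‖u‖ ^ 2 / 2)) * ‖u‖ ^ 4 := by ring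
    _ ≤ ((2 * Real.pi) ^ (-(p : ℝ) / 2) * B * Real.exp (-‖u‖ ^ 2 / 2)) *
        (32 * Real.exp (‖u‖ ^ 2 / 4)) := by gcongr
    _ = _ := by ring

set_option maxHeartbeats 400000 in
theorem stmt_10 {Θ : Type*} [MetricSpace Θ] [CompactSpace Θ]
    (p J : ℕ) (σmin σmax : ℝ) (hσmin : 0 < σmin) (hσminmax : σmin ≤ σmax)
    (σ : Θ → ℝ) (hσ : ∀ θ, σ θ ∈ Set.Icc σmin σmax) (hσcont : Continuous σ)
    (g : Θ → EuclideanSpace ℝ (Fin p) → EuclideanSpace ℝ (Fin J))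
    (hg : Continuous fun q : Θ × EuclideanSpace ℝ (Fin p) => g q.1 q.2)
    (hg4 : Integrable (fun ξ => ⨆ θ : Θ, ‖g θ ξ‖ ^ 4) (stdGaussian p))
    (F : EuclideanSpace ℝ (Fin J) → Θ → ℝ)
    (hF : ∀ y θ, F y θ =
      ∫ ξ, Real.exp (-‖y - g θ ξ‖ ^ 2 / (2 * (σ θ) ^ 2)) ∂(stdGaussian p)) :
    (⨆ θ' : Θ, ∫⁻ ξ, ∫⁻ u,
        ENNReal.ofReal (⨆ θ : Θ, (Real.log (F (g θ' ξ + σ θ' • u) θ)) ^ 2)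
          ∂(stdGaussian J) ∂(stdGaussian p)) < ⊤ := by
  have := aux_prob p
  have := aux_prob J
  set G : EuclideanSpace ℝ (Fin p) → ℝ := fun ξ => ⨆ θ : Θ, ‖g θ ξ‖ ^ 4 with hG
  have hG0 : ∀ ξ, 0 ≤ G ξ := fun ξ => Real.iSup_nonneg fun θ => by positivity
  have hgG : ∀ θ ξ, ‖g θ ξ‖ ^ 4 ≤ G ξ := by
    intro θ ξ
    have hc : Continuous fun θ => ‖g θ ξ‖ ^ 4 := by
      have : Continuous fun θ => g θ ξ := hg.comp (by fun_prop : Continuous fun θ : Θ => (θ, ξ))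
      fun_prop
    exact le_ciSup (isCompact_range hc).bddAbove θ
  clear_value G
  set C : ℝ := ∫ ξ, G ξ ∂(stdGaussian p) with hC
  clear_value C
  have hC0 : 0 ≤ C := hC ▸ integral_nonneg hG0
  have hlow : ∀ y θ, Real.exp (-((‖y‖ ^ 2 + 1 + C) / σmin ^ 2)) ≤ F y θ := by
    intro y θ
    have hint : Integrable (fun ξ => -((‖y‖ ^ 2 + 1 + G ξ) / σmin ^ 2)) (stdGaussian p) :=
      (((integrable_const _).add hg4).div_const _).neg
    have hexp : Integrable (fun ξ => Real.exp (-((‖y‖ ^ 2 + 1 + G ξ) / σmin ^ 2)))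
        (stdGaussian p) := by
      refine Integrable.of_bound
        (Real.continuous_exp.comp_aestronglyMeasurable hint.aestronglyMeasurable) 1
        (.of_forall fun ξ => ?_)
      rw [Real.norm_eq_abs, abs_of_pos (Real.exp_pos _), Real.exp_le_one_iff]
      have := hG0 ξ
      rw [neg_nonpos]; positivity
    have hJ := convexOn_exp.map_integral_le (μ := stdGaussian p)
      (f := fun ξ => -((‖y‖ ^ 2 + 1 + G ξ) / σmin ^ 2))
      Real.continuous_exp.continuousOn isClosed_univ (.of_forall fun _ => Set.mem_univ _)
      hint hexp
    have hm : ∫ ξ, -((‖y‖ ^ 2 + 1 + G ξ) / σmin ^ 2) ∂(stdGaussian p)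
        = -((‖y‖ ^ 2 + 1 + C) / σmin ^ 2) := by
      rw [integral_neg, integral_div, integral_add (integrable_const _) hg4]
      simp [hC]
    rw [hm] at hJ
    refine hJ.trans ?_
    rw [hF]
    have hgc : Continuous fun ξ => g θ ξ :=
      hg.comp (by fun_prop : Continuous fun ξ : EuclideanSpace ℝ (Fin p) => (θ, ξ))
    refine integral_mono hexp ?_ fun ξ => ?_
    · refine Integrable.of_bound (Continuous.aestronglyMeasurable (by fun_prop)) 1
        (.of_forall fun ξ => ?_)
      rw [Real.norm_eq_abs, abs_of_pos (Real.exp_pos _), Real.exp_le_one_iff, neg_div,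
        neg_nonpos]
      positivity
    · apply Real.exp_le_exp.mpr
      rw [neg_div, neg_le_neg_iff]
      have h1 : ‖y - g θ ξ‖ ^ 2 ≤ 2 * (‖y‖ ^ 2 + 1 + G ξ) := by
        have a := norm_sub_le y (g θ ξ)
        have b := hgG θ ξ
        have c : ‖y - g θ ξ‖ ^ 2 ≤ (‖y‖ + ‖g θ ξ‖) ^ 2 := by gcongr
        nlinarith [sq_nonneg (‖y‖ - ‖g θ ξ‖), sq_nonneg (‖g θ ξ‖ ^ 2 - 1),
          sq_nonneg (‖g θ ξ‖)]
      have h2 : σmin ^ 2 ≤ σ θ ^ 2 := by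
        have := (hσ θ).1
        gcongr
      have := hG0 ξ
      calc _ ≤ (2 * (‖y‖ ^ 2 + 1 + G ξ)) / (2 * σmin ^ 2) := by gcongr
        _ = _ := by field_simp
  have hup : ∀ y θ, F y θ ≤ 1 := by
    intro y θ
    rw [hF]
    have h := norm_integral_le_of_norm_le_const (μ := stdGaussian p)
      (f := fun ξ => Real.exp (-‖y - g θ ξ‖ ^ 2 / (2 * (σ θ) ^ 2))) (C := 1)
      (.of_forall fun ξ => by
        rw [Real.norm_eq_abs, abs_of_pos (Real.exp_pos _), Real.exp_le_one_iff, neg_div,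
          neg_nonpos]
        positivity)
    simp only [probReal_univ, mul_one] at h
    exact (le_abs_self _).trans h
  have hlog : ∀ y θ, (Real.log (F y θ)) ^ 2 ≤ ((‖y‖ ^ 2 + 1 + C) / σmin ^ 2) ^ 2 := by
    intro y θ
    have hpos : 0 < F y θ := (Real.exp_pos _).trans_le (hlow y θ)
    have h1 : -((‖y‖ ^ 2 + 1 + C) / σmin ^ 2) ≤ Real.log (F y θ) :=
      (Real.le_log_iff_exp_le hpos).mpr (hlow y θ)
    have h2 : Real.log (F y θ) ≤ 0 := Real.log_nonpos hpos.le (hup y θ)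
    apply sq_le_sq'
    · exact h1
    · exact h2.trans (by positivity)
  have hbd : ∀ θ' ξ u, (⨆ θ : Θ, (Real.log (F (g θ' ξ + σ θ' • u) θ)) ^ 2) ≤
      (2 * (1 + C) ^ 2 / σmin ^ 4 + 16 / σmin ^ 4 * G ξ) +
        (16 * σmax ^ 4 / σmin ^ 4) * ‖u‖ ^ 4 := by
    intro θ' ξ u
    have hGξ := hG0 ξ
    refine Real.iSup_le (fun θ => (hlog _ θ).trans ?_) (by positivity)
    generalize hyd : g θ' ξ + σ θ' • u = y
    have hσ0 : 0 < σ θ' := hσmin.trans_le (hσ θ').1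
    have hy : ‖y‖ ≤ ‖g θ' ξ‖ + σmax * ‖u‖ := by
      rw [← hyd]
      refine (norm_add_le _ _).trans ?_
      rw [norm_smul, Real.norm_eq_abs, abs_of_pos hσ0]
      have := (hσ θ').2
      gcongr
    have h4 : ‖y‖ ^ 4 ≤ 8 * (G ξ + σmax ^ 4 * ‖u‖ ^ 4) := by
      have hs : 0 ≤ σmax := hσmin.le.trans hσminmax
      have := add_pow_le (norm_nonneg (g θ' ξ)) (mul_nonneg hs (norm_nonneg u)) 4
      have h5 : ‖y‖ ^ 4 ≤ (‖g θ' ξ‖ + σmax * ‖u‖) ^ 4 := by gcongr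
      have := hgG θ' ξ
      rw [mul_pow] at *
      norm_num at *
      linarith
    rw [div_pow, ← pow_mul]
    have h6 : (‖y‖ ^ 2 + 1 + C) ^ 2 ≤
        2 * (1 + C) ^ 2 + 16 * G ξ + 16 * σmax ^ 4 * ‖u‖ ^ 4 := by
      nlinarith [sq_nonneg (‖y‖ ^ 2 - (1 + C))]
    calc _ ≤ (2 * (1 + C) ^ 2 + 16 * G ξ + 16 * σmax ^ 4 * ‖u‖ ^ 4) / σmin ^ (2 * 2) := by
          gcongr
      _ = _ := by norm_num; ring
  set K := ∫⁻ u, ENNReal.ofReal ((16 * σmax ^ 4 / σmin ^ 4) * ‖u‖ ^ 4) ∂(stdGaussian J) with hK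
  have hKt : K < ⊤ := aux_moment J _ (by positivity)
  have hL : ∫⁻ ξ, ENNReal.ofReal (2 * (1 + C) ^ 2 / σmin ^ 4 + 16 / σmin ^ 4 * G ξ)
      ∂(stdGaussian p) < ⊤ :=
    ((integrable_const _).add (hg4.const_mul _)).lintegral_lt_top
  refine lt_of_le_of_lt (iSup_le fun θ' => ?_) (ENNReal.add_lt_top.mpr ⟨hL, hKt⟩)
  calc _ ≤ ∫⁻ ξ, (ENNReal.ofReal (2 * (1 + C) ^ 2 / σmin ^ 4 + 16 / σmin ^ 4 * G ξ) + K)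
        ∂(stdGaussian p) := by
        refine lintegral_mono fun ξ => ?_
        calc _ ≤ ∫⁻ u, (ENNReal.ofReal (2 * (1 + C) ^ 2 / σmin ^ 4 + 16 / σmin ^ 4 * G ξ) +
              ENNReal.ofReal ((16 * σmax ^ 4 / σmin ^ 4) * ‖u‖ ^ 4)) ∂(stdGaussian J) := by
              refine lintegral_mono fun u => ?_
              exact (ENNReal.ofReal_le_ofReal (hbd θ' ξ u)).trans ENNReal.ofReal_add_le
          _ = _ := by
              rw [lintegral_add_left measurable_const]; simp [hK]
    _ = _ := by
        rw [lintegral_add_right _ measurable_const]; simp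
end
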